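/- There is no group G of order 32 such that G has exactly one involution (exactly one element g with g ≠ 1 and g² = 1) and the set of squares S = {g² : g ∈ G} has at most 4 elements. -/

import Mathlib

/-- If every conjugate of `s` is `s` or `s⁻¹`, then the centralizer of `s` has index at most two. -/
theorem natCard_le_two_mul_of_conj_eq_or_eq_inv {G : Type*} [Group G] {s : G}
    (hconj : ∀ g : G, g * s * g⁻¹ = s ∨ g * s * g⁻¹ = s⁻¹) (K : Finset G)
    (hK : ∀ g : G, Commute g s → g ∈ K) : Nat.card G ≤ 2 * K.card := by
  classical
  have key : ∃ a : G, ∀ g : G, g ∈ K ∪ K.image (a * ·) := by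
    by_cases hall : ∀ g : G, Commute g s
    · exact ⟨1, fun g => Finset.mem_union_left _ (hK g (hall g))⟩
    · push Not at hall
      obtain ⟨a, ha⟩ := hall
      have flip : ∀ g : G, ¬ Commute g s → g * s * g⁻¹ = s⁻¹ := fun g hg =>
        (hconj g).resolve_left fun h => hg (mul_inv_eq_iff_eq_mul.mp h)
      refine ⟨a, fun g => ?_⟩
      by_cases hg : Commute g s
      · exact Finset.mem_union_left _ (hK g hg)
      · refine Finset.mem_union_right _ (Finset.mem_image.mpr ⟨a⁻¹ * g, hK _ ?_, by simp⟩)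
        have h : g * s * g⁻¹ = a * s * a⁻¹ := (flip g hg).trans (flip a ha).symm
        have h' : g * s = a * s * a⁻¹ * g := mul_inv_eq_iff_eq_mul.mp h
        rw [Commute, SemiconjBy, mul_assoc, h']
        group
  obtain ⟨a, ha⟩ := key
  have huniv : (Set.univ : Set G) = ↑(K ∪ K.image (a * ·)) :=
    (Set.eq_univ_of_forall ha).symm
  rw [← Set.ncard_univ, huniv, Set.ncard_coe_finset]
  have h1 := Finset.card_union_le K (K.image (a * ·))
  have h2 : (K.image (a * ·)).card ≤ K.card := Finset.card_image_le
  omega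

/-- A `2`-power torsion element with `g ^ 2 ^ k ≠ 1` has a power of order `2 ^ (k + 1)`. -/
theorem exists_pow_two_pow_succ_eq_one {G : Type*} [Group G] (k m : ℕ) (g : G)
    (hg : g ^ 2 ^ k ≠ 1) (hm : g ^ 2 ^ (k + m) = 1) :
    ∃ x : G, x ^ 2 ^ k ≠ 1 ∧ x ^ 2 ^ (k + 1) = 1 := by
  induction m generalizing g with
  | zero => exact absurd hm hg
  | succ m ih =>
    by_cases h : (g ^ 2) ^ 2 ^ k = 1
    · exact ⟨g, hg, by rwa [pow_succ', pow_mul]⟩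
    · exact ih (g ^ 2) h (by rwa [← pow_mul, ← pow_succ'])

/-- If `s ^ 2` is the only involution, then an element commuting with `s` whose square is
`1` or `s ^ 2` is a power of `s`. -/
theorem eq_pow_of_commute_of_sq {G : Type*} [Group G] {s y : G} (hs : s ^ 4 = 1)
    (huniq : ∀ g : G, g ^ 2 = 1 → g = 1 ∨ g = s ^ 2) (hc : Commute y s)
    (hy : y ^ 2 = 1 ∨ y ^ 2 = s ^ 2) : y = 1 ∨ y = s ∨ y = s ^ 2 ∨ y = s ^ 3 := by
  rcases hy with hy | hy
  · rcases huniq y hy with h | h <;> simp [h]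
  · have h : (y * s) ^ 2 = 1 := by rw [hc.mul_pow, hy, ← pow_add, hs]
    rcases huniq _ h with h | h
    · refine .inr (.inr (.inr (mul_right_cancel (b := s) ?_)))
      rw [h, ← pow_succ, hs]
    · refine .inr (.inl (mul_right_cancel (b := s) ?_))
      rw [h, sq]

/-- Two square roots of `s` whose product squares into `⟨s⟩` satisfy `(x * y) ^ 2 ∈ {1, s ^ 2}`. -/
theorem mul_sq_eq_one_or_sq {G : Type*} [Group G] {s x y : G} (hs : s ^ 4 = 1) (hs2 : s ^ 2 ≠ 1)
    (hx : x ^ 2 = s) (hy : y ^ 2 = s)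
    (hxy : (x * y) ^ 2 = 1 ∨ (x * y) ^ 2 = s ∨ (x * y) ^ 2 = s ^ 2 ∨ (x * y) ^ 2 = s ^ 3) :
    (x * y) ^ 2 = 1 ∨ (x * y) ^ 2 = s ^ 2 := by
  have hcx : Commute x s := hx ▸ (Commute.refl x).pow_right 2
  have hcy : Commute y s := hy ▸ (Commute.refl y).pow_right 2
  have main : ∀ n : ℕ, (x * y) ^ 2 = s ^ n → s ^ (2 * n) = 1 := by
    intro n hn
    have h1 : s * (y * x) * s = s ^ n * (x * y) := by
      calc s * (y * x) * s = x ^ 2 * (y * x) * y ^ 2 := by rw [hx, hy]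
        _ = x * (x * y) ^ 2 * y := by simp only [sq, mul_assoc]
        _ = s ^ n * (x * y) := by rw [hn, (hcx.pow_right n).eq, mul_assoc]
    have h2 : s ^ 2 * (y * x) = s ^ n * (x * y) := by
      rw [← h1, mul_assoc s, ((hcy.mul_left hcx).eq), sq, mul_assoc]
    have h3 : s ^ 4 * (y * s) = s ^ (2 * n) * (y * s) := by
      calc s ^ 4 * (y * s) = s ^ 2 * (s ^ 2 * (y * x)) * x := by
            rw [← hx]; simp only [pow_succ, pow_zero, one_mul, mul_assoc]
        _ = s ^ 2 * s ^ n * x * (y * x) := by rw [h2]; simp only [mul_assoc]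
        _ = s ^ n * x * (s ^ 2 * (y * x)) := by
            rw [← pow_add, add_comm, pow_add, mul_assoc (s ^ n), ← (hcx.pow_right 2).eq]
            simp only [mul_assoc]
        _ = s ^ n * (x * s ^ n) * (x * y) := by rw [h2]; simp only [mul_assoc]
        _ = s ^ (2 * n) * (x ^ 2 * y) := by
            rw [(hcx.pow_right n).eq, two_mul, pow_add, sq]; simp only [mul_assoc]
        _ = s ^ (2 * n) * (y * s) := by rw [hx, hcy.eq]
    rw [← mul_right_cancel h3, hs]
  rcases hxy with h | h | h | h
  · exact .inl h
  · exact absurd (main 1 (by rw [h, pow_one])) hs2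
  · exact .inr h
  · refine absurd (main 3 h) fun h6 => hs2 ?_
    rwa [show 2 * 3 = 4 + 2 from rfl, pow_add, hs, one_mul] at h6

/-- If `s ^ 2` is the only involution and all squares lie in `{1, s, s ^ 2, s ^ 3}`, then any two
square roots of `s` differ by a power of `s`. -/
theorem eq_mul_pow_of_sq_eq {G : Type*} [Group G] {s x y : G} (hs : s ^ 4 = 1) (hs2 : s ^ 2 ≠ 1)
    (huniq : ∀ g : G, g ^ 2 = 1 → g = 1 ∨ g = s ^ 2)
    (hsq : ∀ g : G, g ^ 2 = 1 ∨ g ^ 2 = s ∨ g ^ 2 = s ^ 2 ∨ g ^ 2 = s ^ 3)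
    (hx : x ^ 2 = s) (hy : y ^ 2 = s) :
    y = x ∨ y = x * s ∨ y = x * s ^ 2 ∨ y = x * s ^ 3 := by
  have hcx : Commute x s := hx ▸ (Commute.refl x).pow_right 2
  have hcy : Commute y s := hy ▸ (Commute.refl y).pow_right 2
  rcases eq_pow_of_commute_of_sq hs huniq (hcx.mul_left hcy)
    (mul_sq_eq_one_or_sq hs hs2 hx hy (hsq _)) with h | h | h | h
  all_goals
    have h' : s * y = x * (x * y) := by rw [← mul_assoc, ← sq, hx]
    have e : y = s ^ 3 * (x * (x * y)) := by
      rw [← h', ← mul_assoc, ← pow_succ, hs, one_mul]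
    rw [h, ← mul_assoc, ← (hcx.pow_right 3).eq, mul_assoc] at e
  · simp [e]
  · rw [← pow_succ, hs, mul_one] at e
    exact .inl e
  · rw [← pow_add, show 3 + 2 = 4 + 1 from rfl, pow_add, hs, one_mul, pow_one] at e
    exact .inr (.inl e)
  · rw [← pow_add, show 3 + 3 = 4 + 2 from rfl, pow_add, hs, one_mul] at e
    exact .inr (.inr (.inl e))

/-- A group of exponent dividing `4` with a unique involution `s ^ 2` has order at most `8`. -/
theorem natCard_le_eight_of_pow_four {G : Type*} [Group G] {s : G}
    (huniq : ∀ g : G, g ^ 2 = 1 → g = 1 ∨ g = s ^ 2) (h4 : ∀ g : G, g ^ 4 = 1) :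
    Nat.card G ≤ 8 := by
  classical
  have hsq : ∀ g : G, g ^ 2 = 1 ∨ g ^ 2 = s ^ 2 := fun g =>
    huniq _ (by rw [← pow_mul]; exact h4 g)
  have hinv : ∀ g : G, (g ^ 2)⁻¹ = g ^ 2 := fun g => by
    rw [inv_eq_iff_mul_eq_one, ← pow_add]; exact h4 g
  have hconj : ∀ g : G, g * s * g⁻¹ = s ∨ g * s * g⁻¹ = s⁻¹ := by
    intro g
    have e : g * s * g⁻¹ = (g * s) ^ 2 * s⁻¹ * (g ^ 2)⁻¹ := by simp only [sq]; group
    have f : s ^ 2 * s⁻¹ = s := by group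
    have f' : s * s ^ 2 = s⁻¹ := by
      rw [eq_inv_iff_mul_eq_one, ← pow_succ', ← pow_succ]; exact h4 s
    have f'' : s⁻¹ * s ^ 2 = s := by group
    rw [hinv] at e
    rcases hsq (g * s) with h | h <;> rcases hsq g with h' | h' <;> rw [e, h, h'] <;>
      simp [f, f', f'']
  have hle : Finset.card {1, s, s ^ 2, s ^ 3} ≤ 4 := Finset.card_le_four
  have := natCard_le_two_mul_of_conj_eq_or_eq_inv hconj {1, s, s ^ 2, s ^ 3} fun g hg => by
    simpa using eq_pow_of_commute_of_sq (h4 s) huniq hg (hsq g)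
  omega

/-- A group with a unique involution `x ^ 4`, in which all squares are powers of `x ^ 2`,
has order at most `16`. -/
theorem natCard_le_sixteen_of_sq_mem {G : Type*} [Group G] {s x : G} (hs : s ^ 4 = 1)
    (hs2 : s ^ 2 ≠ 1) (hx : x ^ 2 = s)
    (huniq : ∀ g : G, g ^ 2 = 1 → g = 1 ∨ g = s ^ 2)
    (hsq : ∀ g : G, g ^ 2 = 1 ∨ g ^ 2 = s ∨ g ^ 2 = s ^ 2 ∨ g ^ 2 = s ^ 3) :
    Nat.card G ≤ 16 := by
  classical
  have hs3 : s ^ 3 = s⁻¹ := by rw [eq_inv_iff_mul_eq_one, ← pow_succ, hs]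
  have hcx : Commute x s := hx ▸ (Commute.refl x).pow_right 2
  have hconj : ∀ g : G, g * s * g⁻¹ = s ∨ g * s * g⁻¹ = s⁻¹ := by
    intro g
    have e : (g * x * g⁻¹) ^ 2 = g * s * g⁻¹ := by rw [conj_pow, hx]
    have e2 : (g * s * g⁻¹) ^ 2 ≠ 1 := by
      rw [conj_pow]; simpa using hs2
    rcases hsq (g * x * g⁻¹) with h | h | h | h <;> rw [e] at h
    · simp [h] at e2
    · exact .inl h
    · exact absurd (by rw [h, ← pow_mul]; exact hs) e2
    · exact .inr (h.trans hs3)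
  have hle : Finset.card ({1, s, s ^ 2, s ^ 3} ∪ {x, x * s, x * s ^ 2, x * s ^ 3}) ≤ 8 :=
    (Finset.card_union_le _ _).trans (add_le_add Finset.card_le_four Finset.card_le_four)
  have := natCard_le_two_mul_of_conj_eq_or_eq_inv hconj
    ({1, s, s ^ 2, s ^ 3} ∪ {x, x * s, x * s ^ 2, x * s ^ 3}) fun g hg => by
      rw [Finset.mem_union]
      simp only [Finset.mem_insert, Finset.mem_singleton]
      rcases hsq g with h | h | h | h
      · exact .inl (eq_pow_of_commute_of_sq hs huniq hg (.inl h))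
      · exact .inr (eq_mul_pow_of_sq_eq hs hs2 huniq hsq hx h)
      · exact .inl (eq_pow_of_commute_of_sq hs huniq hg (.inr h))
      · have hgs : (g * s) ^ 2 = s := by
          rw [hg.mul_pow, h, ← pow_add, show 3 + 2 = 4 + 1 from rfl, pow_add, hs, one_mul, pow_one]
        have hg' : g = g * s * s ^ 3 := by rw [mul_assoc, ← pow_succ', hs, mul_one]
        rcases eq_mul_pow_of_sq_eq hs hs2 huniq hsq hx hgs with e | e | e | e <;> rw [e] at hg'
        · exact .inr (.inr (.inr (.inr hg')))
        · rw [mul_assoc, ← pow_succ', hs, mul_one] at hg'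
          exact .inr (.inl hg')
        · rw [mul_assoc, ← pow_add, show 2 + 3 = 4 + 1 from rfl, pow_add, hs, one_mul,
            pow_one] at hg'
          exact .inr (.inr (.inl hg'))
        · rw [mul_assoc, ← pow_add, show 3 + 3 = 4 + 2 from rfl, pow_add, hs, one_mul] at hg'
          exact .inr (.inr (.inr (.inl hg')))
  omega

/-- If `x` has order `8` and there are at most four squares, then they are the powers of `x ^ 2`. -/
theorem sq_eq_pow_of_ncard_le_four {G : Type*} [Group G] [Finite G] {x : G} (hx4 : x ^ 4 ≠ 1)
    (hx8 : x ^ 8 = 1) (hS : Set.ncard {a : G | ∃ g : G, a = g ^ 2} ≤ 4) (g : G) :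
    g ^ 2 = 1 ∨ g ^ 2 = x ^ 2 ∨ g ^ 2 = (x ^ 2) ^ 2 ∨ g ^ 2 = (x ^ 2) ^ 3 := by
  classical
  have ho : orderOf x = 8 := orderOf_eq_prime_pow (p := 2) (n := 2) hx4 hx8
  let T : Finset G := (Finset.range 4).image fun i => (x ^ 2) ^ i
  have hT : T.card = 4 := by
    rw [Finset.card_image_of_injOn, Finset.card_range]
    intro i hi j hj hij
    simp only [Finset.coe_range, Set.mem_Iio] at hi hj
    simp only [← pow_mul] at hij
    have := pow_injOn_Iio_orderOf (x := x) (by simp [ho]; omega) (by simp [ho]; omega) hij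
    omega
  have hsub : (T : Set G) ⊆ {a : G | ∃ g : G, a = g ^ 2} := by
    intro a ha
    obtain ⟨i, -, rfl⟩ := Finset.mem_image.mp (Finset.mem_coe.mp ha)
    exact ⟨x ^ i, by rw [← pow_mul, ← pow_mul, mul_comm]⟩
  have heq := Set.eq_of_subset_of_ncard_le hsub (by rwa [Set.ncard_coe_finset, hT])
    (Set.toFinite _)
  have hg : g ^ 2 ∈ (T : Set G) := heq ▸ ⟨g, rfl⟩
  obtain ⟨i, hi, hig⟩ := Finset.mem_image.mp (Finset.mem_coe.mp hg)
  rw [← hig]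
  have hi4 := Finset.mem_range.mp hi
  interval_cases i <;> simp

/-- There is no group of order 32 with exactly one involution and at most 4 squares. -/
theorem no_group_of_order_32 :
    ¬ ∃ (G : Type) (_ : Group G), Nat.card G = 32 ∧
      (∃! g : G, g ≠ 1 ∧ g ^ 2 = 1) ∧
      Set.ncard {x : G | ∃ g : G, x = g ^ 2} ≤ 4 := by
  rintro ⟨G, _, hcard, ⟨z, -, hz⟩, hS⟩
  have : Finite G := Nat.finite_of_card_ne_zero (by omega)
  have huniq : ∀ s : G, s ^ 2 ≠ 1 → s ^ 4 = 1 → ∀ g : G, g ^ 2 = 1 → g = 1 ∨ g = s ^ 2 := by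
    intro s hs hs4 g hg
    refine or_iff_not_imp_left.mpr fun h => (hz g ⟨h, hg⟩).trans (hz _ ⟨hs, ?_⟩).symm
    rwa [← pow_mul]
  have h32 : ∀ g : G, g ^ 32 = 1 := fun g => hcard ▸ pow_card_eq_one'
  by_cases h4 : ∀ g : G, g ^ 4 = 1
  · by_cases h2 : ∀ g : G, g ^ 2 = 1
    · have huniv : (Set.univ : Set G) ⊆ {1, z} := fun g _ =>
        or_iff_not_imp_left.mpr fun h => hz g ⟨h, h2 g⟩
      have h := Set.ncard_le_ncard huniv (Set.toFinite _)
      rw [Set.ncard_univ, hcard] at h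
      have := Set.ncard_insert_le (1 : G) {z}
      rw [Set.ncard_singleton] at this
      omega
    · push Not at h2
      obtain ⟨s, hs⟩ := h2
      have := natCard_le_eight_of_pow_four (huniq s hs (h4 s)) h4
      omega
  · push Not at h4
    obtain ⟨g, hg⟩ := h4
    obtain ⟨x, hx4, hx8⟩ := exists_pow_two_pow_succ_eq_one 2 3 g hg (h32 g)
    have hs2 : (x ^ 2) ^ 2 ≠ 1 := by rwa [← pow_mul]
    have hs4 : (x ^ 2) ^ 4 = 1 := by rw [← pow_mul]; exact hx8
    have := natCard_le_sixteen_of_sq_mem hs4 hs2 rfl (huniq _ hs2 hs4)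
      (sq_eq_pow_of_ncard_le_four hx4 hx8 hS)
    omega
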